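/- For every x ∈ ℝ, lim_{r→0⁺} ( Σ_{λ : ∃ i ≥ 1, λ_i − i = ⌊x/r⌋} e^{−r|λ|} ) / ( Σ_{λ} e^{−r|λ|} ) = e^{−x}/(1 + e^{−x}), where the sums run over all partitions λ. That is, under the canonical measure on partitions with q = e^{−r}, the probability that the Maya-diagram site at position ⌊x/r⌋ + 1/2 is occupied by a particle converges to the logistic profile e^{−x}/(1+e^{−x}) as r → 0⁺. -/

import Mathlib

/-- An integer partition: a weakly decreasing sequence of nonnegative integers with only
finitely many nonzero terms; `part i` is the `(i+1)`-st part `λ_{i+1}`. -/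
structure IntPartition where
  part : ℕ → ℕ
  antitone : Antitone part
  finite_supp : (Function.support part).Finite

/-- The size `|λ| = Σ_i λ_i` of a partition. -/
noncomputable def IntPartition.size (lam : IntPartition) : ℕ := ∑ᶠ i, lam.part i

namespace IntPartition

lemma ext_part {lam mu : IntPartition} (h : ∀ i, lam.part i = mu.part i) : lam = mu := by
  cases lam; cases mu
  congr
  exact funext h

lemma exists_part_eq_zero (lam : IntPartition) : ∃ N, ∀ i, N ≤ i → lam.part i = 0 := by
  obtain ⟨N, hN⟩ := lam.finite_supp.bddAbove
  refine ⟨N + 1, fun i hi => ?_⟩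
  by_contra h
  have : i ≤ N := hN h
  omega

lemma size_eq_sum_range (lam : IntPartition) {N : ℕ} (hN : ∀ i, N ≤ i → lam.part i = 0) :
    lam.size = ∑ i ∈ Finset.range N, lam.part i := by
  refine finsum_eq_sum_of_support_subset _ fun i hi => ?_
  by_contra h
  exact hi (hN i (by simpa using h))

/-- The site `n + 1/2` of the Maya diagram of `lam` is occupied. -/
def Occupied (n : ℤ) (lam : IntPartition) : Prop :=
  ∃ j : ℕ, (lam.part j : ℤ) - (j : ℤ) - 1 = n

/-! ### Summability of the canonical weights -/

/-- The set of pairs `(i, λ_i - λ_{i+1})` with nonzero second entry. -/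
noncomputable def descents (lam : IntPartition) : ℕ →₀ ℕ :=
  Finsupp.ofSupportFinite (fun i => lam.part i - lam.part (i + 1)) <|
    lam.finite_supp.subset fun i hi => by
      simp only [Function.mem_support] at hi ⊢
      omega

lemma descents_apply (lam : IntPartition) (i : ℕ) :
    lam.descents i = lam.part i - lam.part (i + 1) := rfl

lemma descents_injective : Function.Injective descents := by
  intro lam mu h
  obtain ⟨N, hN⟩ := lam.exists_part_eq_zero
  obtain ⟨M, hM⟩ := mu.exists_part_eq_zero
  have key : ∀ k i, N + M ≤ i + k → lam.part i = mu.part i := by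
    intro k
    induction k with
    | zero => intro i hi; rw [hN i (by omega), hM i (by omega)]
    | succ k ih =>
      intro i hi
      have h1 := ih (i + 1) (by omega)
      have h2 := DFunLike.congr_fun h i
      rw [descents_apply, descents_apply] at h2
      have h3 := lam.antitone (Nat.le_succ i)
      have h4 := mu.antitone (Nat.le_succ i)
      simp only [Nat.succ_eq_add_one] at h3 h4
      omega
  exact ext_part fun i => key (N + M) i (by omega)

lemma size_eq_sum_descents (lam : IntPartition) :
    lam.size = ∑ i ∈ lam.descents.support, (i + 1) * lam.descents i := by
  obtain ⟨N, hN⟩ := lam.exists_part_eq_zero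
  have abel : ∀ m, ∑ i ∈ Finset.range m, (i + 1) * lam.descents i + m * lam.part m =
      ∑ i ∈ Finset.range m, lam.part i := by
    intro m
    induction m with
    | zero => simp
    | succ m ih =>
      rw [Finset.sum_range_succ, Finset.sum_range_succ, ← ih, descents_apply]
      obtain ⟨c, hc⟩ := Nat.exists_eq_add_of_le (lam.antitone (Nat.le_succ m))
      simp only [Nat.succ_eq_add_one] at hc
      rw [hc, Nat.add_sub_cancel_left]
      ring
  rw [lam.size_eq_sum_range hN, ← abel N, hN N le_rfl, mul_zero, add_zero]
  symm
  refine Finset.sum_subset (fun i hi => ?_) fun i _ hi => ?_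
  · by_contra h
    rw [Finsupp.mem_support_iff, descents_apply, hN i (by simpa using h)] at hi
    simp at hi
  · rw [Finsupp.notMem_support_iff.1 hi, mul_zero]

lemma summable_pow_size {q : ℝ} (hq0 : 0 < q) (hq1 : q < 1) :
    Summable fun lam : IntPartition => q ^ lam.size := by
  have hg : Summable fun i : ℕ => q ^ i := summable_geometric_of_lt_one hq0.le hq1
  have hf : Summable fun p : ℕ × ℕ => q ^ p.1 * q ^ p.2 :=
    hg.mul_of_nonneg hg (fun i => by positivity) fun i => by positivity
  have hs : Summable fun s : Finset (ℕ × ℕ) => ∏ p ∈ s, q ^ p.1 * q ^ p.2 :=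
    summable_finsetProd_of_summable_nonneg (fun p => by positivity) hf
  have hinj : Function.Injective fun lam : IntPartition => lam.descents.graph :=
    (Finsupp.graph_injective ℕ ℕ).comp descents_injective
  refine Summable.of_nonneg_of_le (fun lam => by positivity) (fun lam => ?_)
    (hs.comp_injective hinj)
  simp only [Function.comp_apply, Finsupp.graph, Finset.prod_map]
  rw [size_eq_sum_descents, ← Finset.prod_pow_eq_pow_sum]
  refine Finset.prod_le_prod (fun i _ => by positivity) fun i hi => ?_
  change q ^ ((i + 1) * lam.descents i) ≤ q ^ i * q ^ lam.descents i
  rw [← pow_add]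
  refine pow_le_pow_of_le_one hq0.le hq1.le ?_
  have : 1 ≤ lam.descents i := Nat.one_le_iff_ne_zero.2 (Finsupp.mem_support_iff.1 hi)
  nlinarith

/-! ### Removing a particle -/

/-- Delete the `j`-th row and add one box to each row above it. -/
def removeRow (lam : IntPartition) (j : ℕ) : IntPartition where
  part i := if i < j then lam.part i + 1 else lam.part (i + 1)
  antitone := antitone_nat_of_succ_le fun i => by
    have h1 := lam.antitone (Nat.le_succ i)
    have h2 := lam.antitone (Nat.le_succ (i + 1))
    simp only [Nat.succ_eq_add_one] at h1 h2
    split_ifs <;> omega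
  finite_supp := by
    obtain ⟨N, hN⟩ := lam.exists_part_eq_zero
    refine (Set.finite_lt_nat (N + j)).subset fun i hi => ?_
    by_contra h
    simp only [Set.mem_ofPred_eq, not_lt] at h
    refine hi ?_
    beta_reduce
    rw [if_neg (by omega), hN _ (by omega)]

lemma removeRow_part (lam : IntPartition) (j i : ℕ) :
    (lam.removeRow j).part i = if i < j then lam.part i + 1 else lam.part (i + 1) := rfl

lemma size_removeRow (lam : IntPartition) (j : ℕ) :
    (lam.removeRow j).size + lam.part j = lam.size + j := by
  obtain ⟨N, hN⟩ := lam.exists_part_eq_zero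
  have h1 : ∑ i ∈ Finset.range j, (lam.removeRow j).part i =
      ∑ i ∈ Finset.range j, lam.part i + j := by
    rw [Finset.sum_congr rfl fun i hi => by
      rw [removeRow_part, if_pos (Finset.mem_range.1 hi)], Finset.sum_add_distrib]
    simp
  have h2 : ∀ m, ∑ i ∈ Finset.range (j + m), (lam.removeRow j).part i + lam.part j =
      ∑ i ∈ Finset.range (j + m + 1), lam.part i + j := by
    intro m
    induction m with
    | zero => rw [add_zero, h1, Finset.sum_range_succ]; ring
    | succ m ih =>
      rw [← add_assoc, Finset.sum_range_succ, Finset.sum_range_succ _ (j + m + 1),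
        removeRow_part, if_neg (by omega)]
      omega
  rw [lam.size_eq_sum_range (N := j + N + 1) fun i hi => hN i (by omega),
    (lam.removeRow j).size_eq_sum_range (N := j + N) fun i hi => by
      rw [removeRow_part, if_neg (by omega), hN _ (by omega)], h2 N]

lemma removeRow_gt {lam : IntPartition} {n : ℤ} {j : ℕ} (hj : (lam.part j : ℤ) - j - 1 = n)
    {i : ℕ} (hi : i < j) : n + 1 < ((lam.removeRow j).part i : ℤ) - i - 1 := by
  have := lam.antitone hi.le
  rw [removeRow_part, if_pos hi]
  push_cast
  omega

lemma removeRow_lt {lam : IntPartition} {n : ℤ} {j : ℕ} (hj : (lam.part j : ℤ) - j - 1 = n)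
    {i : ℕ} (hi : j ≤ i) : ((lam.removeRow j).part i : ℤ) - i - 1 < n + 1 := by
  have := lam.antitone (show j ≤ i + 1 by omega)
  rw [removeRow_part, if_neg (by omega)]
  omega

lemma not_occupied_removeRow {lam : IntPartition} {n : ℤ} {j : ℕ}
    (hj : (lam.part j : ℤ) - j - 1 = n) : ¬ Occupied (n + 1) (lam.removeRow j) := by
  rintro ⟨i, hi⟩
  rcases lt_or_ge i j with h | h
  · exact absurd (removeRow_gt hj h) (by omega)
  · exact absurd (removeRow_lt hj h) (by omega)

lemma removeRow_inj {lam mu : IntPartition} {n : ℤ} {j k : ℕ}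
    (hj : (lam.part j : ℤ) - j - 1 = n) (hk : (mu.part k : ℤ) - k - 1 = n)
    (h : lam.removeRow j = mu.removeRow k) : lam = mu := by
  have hjk : j = k := by
    rcases lt_trichotomy j k with hlt | heq | hlt
    · have h1 := removeRow_lt hj le_rfl
      have h2 := removeRow_gt hk hlt
      rw [h] at h1
      omega
    · exact heq
    · have h1 := removeRow_gt hj hlt
      have h2 := removeRow_lt hk le_rfl
      rw [h] at h1
      omega
  subst hjk
  refine ext_part fun i => ?_
  rcases lt_trichotomy i j with hlt | heq | hlt
  · have := congrArg (fun nu => nu.part i) h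
    simp only [removeRow_part, if_pos hlt] at this
    omega
  · subst heq
    omega
  · have := congrArg (fun nu => nu.part (i - 1)) h
    simp only [removeRow_part, if_neg (show ¬ i - 1 < j by omega),
      Nat.sub_add_cancel (show 1 ≤ i by omega)] at this
    exact this

lemma exists_removeRow_eq {mu : IntPartition} {n : ℤ} (h : ¬ Occupied (n + 1) mu) :
    ∃ (lam : IntPartition) (j : ℕ), (lam.part j : ℤ) - j - 1 = n ∧ lam.removeRow j = mu := by
  classical
  obtain ⟨N, hN⟩ := mu.exists_part_eq_zero
  have hne : ∀ i : ℕ, (mu.part i : ℤ) - i - 1 ≠ n + 1 := fun i hi => h ⟨i, hi⟩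
  have hex : ∃ j : ℕ, (mu.part j : ℤ) - j - 1 < n + 1 :=
    ⟨N + n.natAbs + 2, by rw [hN _ (by omega)]; omega⟩
  obtain ⟨j, hjlt, hjmin⟩ : ∃ j : ℕ, (mu.part j : ℤ) - j - 1 < n + 1 ∧
      ∀ i < j, n + 1 < (mu.part i : ℤ) - i - 1 := by
    refine ⟨Nat.find hex, Nat.find_spec hex, fun i hi => ?_⟩
    have h1 := Nat.find_min hex hi
    have h2 := hne i
    omega
  refine ⟨⟨fun i => if i < j then mu.part i - 1 else if i = j then (n + 1 + j).toNat
    else mu.part (i - 1), antitone_nat_of_succ_le fun i => ?_, ?_⟩, j, ?_, ?_⟩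
  · have h1 := mu.antitone (Nat.le_succ i)
    have h2 := mu.antitone (show i - 1 ≤ i by omega)
    simp only [Nat.succ_eq_add_one] at h1
    rcases lt_or_ge i j with hlt | hge
    · have h3 := hjmin i hlt
      rcases lt_or_ge (i + 1) j with hlt' | hge'
      · rw [if_pos hlt, if_pos hlt']
        omega
      · rw [if_pos hlt, if_neg (by omega), if_pos (by omega)]
        omega
    · rw [if_neg (show ¬ i + 1 < j by omega), if_neg (show ¬ i + 1 = j by omega),
        if_neg (show ¬ i < j by omega), Nat.add_sub_cancel]
      split_ifs with h4
      · subst h4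
        omega
      · exact h2
  · refine (Set.finite_lt_nat (N + j + 1)).subset fun i hi => ?_
    by_contra hc
    simp only [Set.mem_ofPred_eq, not_lt] at hc
    refine hi ?_
    beta_reduce
    rw [if_neg (by omega), if_neg (by omega), hN _ (by omega)]
  · simp only [lt_irrefl, if_false, if_true]
    omega
  · refine ext_part fun i => ?_
    rw [removeRow_part]
    simp only []
    split_ifs with h1 h2 h3
    · have h4 := hjmin (j - 1) (by omega)
      have h5 := mu.antitone (show i ≤ j - 1 by omega)
      omega
    all_goals first | omega | simp

/-- Removing the particle at `n + 1/2` and recentring. -/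
noncomputable def removeParticle (n : ℤ) (lam : {lam // Occupied n lam}) :
    {mu // ¬ Occupied (n + 1) mu} :=
  ⟨lam.1.removeRow lam.2.choose, not_occupied_removeRow lam.2.choose_spec⟩

lemma removeParticle_bijective (n : ℤ) : Function.Bijective (removeParticle n) := by
  refine ⟨fun lam mu h => ?_, fun mu => ?_⟩
  · exact Subtype.ext <| removeRow_inj lam.2.choose_spec mu.2.choose_spec
      (congrArg Subtype.val h)
  · obtain ⟨lam, j, hj, h⟩ := exists_removeRow_eq mu.2
    have hocc : Occupied n lam := ⟨j, hj⟩
    refine ⟨⟨lam, hocc⟩, Subtype.ext ?_⟩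
    have hc := hocc.choose_spec
    have : hocc.choose = j := by
      rcases lt_trichotomy hocc.choose j with hlt | heq | hlt
      · have := lam.antitone hlt.le
        omega
      · exact heq
      · have := lam.antitone hlt.le
        omega
    change lam.removeRow hocc.choose = mu.1
    rw [this, h]

lemma size_removeParticle (n : ℤ) (lam : {lam // Occupied n lam}) :
    ((removeParticle n lam).1.size : ℤ) + (n + 1) = lam.1.size := by
  have h1 := size_removeRow lam.1 lam.2.choose
  have h2 := lam.2.choose_spec
  change ((lam.1.removeRow lam.2.choose).size : ℤ) + (n + 1) = lam.1.size
  omega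

/-! ### The occupation probabilities -/

/-- The canonical partition function. -/
noncomputable def partitionSum (q : ℝ) : ℝ := ∑' lam : IntPartition, q ^ lam.size

open scoped Classical in
/-- The canonical probability that the site `n + 1/2` is occupied. -/
noncomputable def occupation (q : ℝ) (n : ℤ) : ℝ :=
  (∑' lam : IntPartition, if Occupied n lam then q ^ lam.size else 0) / partitionSum q

lemma partitionSum_pos {q : ℝ} (hq0 : 0 < q) (hq1 : q < 1) : 0 < partitionSum q :=
  (summable_pow_size hq0 hq1).tsum_pos (fun _ => by positivity)
    ⟨fun _ => 0, antitone_const, by simp⟩ (by positivity)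

open scoped Classical in
lemma occupation_nonneg {q : ℝ} (hq0 : 0 < q) (n : ℤ) : 0 ≤ occupation q n := by
  unfold occupation partitionSum
  refine div_nonneg (tsum_nonneg fun lam => ?_) (tsum_nonneg fun lam => by positivity)
  split_ifs <;> positivity

open scoped Classical in
lemma occupation_recursion {q : ℝ} (hq0 : 0 < q) (hq1 : q < 1) (n : ℤ) :
    occupation q n = q ^ (n + 1) * (1 - occupation q (n + 1)) := by
  have hs := summable_pow_size hq0 hq1
  have hZ := partitionSum_pos hq0 hq1
  have hsub : ∀ p : IntPartition → Prop,
      ∑' lam : IntPartition, (if p lam then q ^ lam.size else 0) =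
        ∑' lam : {lam // p lam}, q ^ lam.1.size := by
    intro p
    refine Eq.trans (tsum_congr fun lam => ?_)
      (tsum_subtype {lam | p lam} fun lam : IntPartition => q ^ lam.size).symm
    simp [Set.indicator_apply]
  have hcompl : ∑' lam : IntPartition, (if Occupied (n + 1) lam then q ^ lam.size else 0) +
      ∑' lam : {lam // ¬ Occupied (n + 1) lam}, q ^ lam.1.size = partitionSum q := by
    rw [hsub]
    exact hs.tsum_subtype_add_tsum_subtype_compl {lam | Occupied (n + 1) lam}
  have hmain : ∑' lam : IntPartition, (if Occupied n lam then q ^ lam.size else 0) =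
      q ^ (n + 1) * ∑' lam : {lam // ¬ Occupied (n + 1) lam}, q ^ lam.1.size := by
    rw [hsub, ← tsum_mul_left,
      ← (Equiv.ofBijective _ (removeParticle_bijective n)).tsum_eq]
    refine tsum_congr fun lam => ?_
    rw [Equiv.ofBijective_apply, ← zpow_natCast, ← zpow_natCast, ← zpow_add₀ hq0.ne',
      ← size_removeParticle n lam, add_comm]
  unfold occupation
  rw [hmain, ← sub_eq_iff_eq_add'.2 hcompl.symm]
  field_simp

end IntPartition

/-! ### Analysis of the recursion -/

section Recursion

variable {q : ℝ} {P : ℤ → ℝ}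

lemma le_zpow_of_recursion (hq0 : 0 < q) (hP : ∀ n, 0 ≤ P n)
    (hrec : ∀ n, P n = q ^ (n + 1) * (1 - P (n + 1))) (n : ℤ) : P n ≤ q ^ (n + 1) := by
  rw [hrec n]
  have := zpow_pos hq0 (n + 1)
  nlinarith [hP (n + 1)]

lemma succ_le_of_recursion_of_large (hq0 : 0 < q) (hP : ∀ n, 0 ≤ P n)
    (hrec : ∀ n, P n = q ^ (n + 1) * (1 - P (n + 1))) {n : ℤ}
    (hn : q ^ (n + 2) ≤ 1 - q) : P (n + 1) ≤ P n := by
  have h1 := le_zpow_of_recursion hq0 hP hrec (n + 1)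
  have hu := zpow_pos hq0 (n + 1)
  have h2 : q ^ (n + 1 + 1) = q ^ (n + 1) * q := zpow_add_one₀ hq0.ne' _
  rw [show n + 2 = n + 1 + 1 by ring] at hn
  rw [hrec n]
  nlinarith

lemma succ_le_of_recursion_step (hq0 : 0 < q) (hq1 : q < 1) (hP : ∀ n, 0 ≤ P n)
    (hrec : ∀ n, P n = q ^ (n + 1) * (1 - P (n + 1))) {n : ℤ} (hn : -1 ≤ n)
    (h1 : P (n + 2) ≤ P (n + 1)) (h2 : P (n + 3) ≤ P (n + 2)) : P (n + 1) ≤ P n := by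
  have e0 := hrec n
  have e1 := hrec (n + 1)
  have e2 := hrec (n + 2)
  have hu := zpow_pos hq0 (n + 1)
  have hu1 : q ^ (n + 1) ≤ 1 := by
    obtain ⟨k, hk⟩ := Int.eq_ofNat_of_zero_le (show 0 ≤ n + 1 by omega)
    rw [hk, zpow_natCast]
    exact pow_le_one₀ hq0.le hq1.le
  rw [show n + 1 + 1 = n + 2 by ring, show n + 2 = n + 1 + 1 by ring,
    zpow_add_one₀ hq0.ne', show n + 1 + 1 = n + 2 by ring] at e1
  rw [show n + 2 + 1 = n + 1 + 1 + 1 by ring, zpow_add_one₀ hq0.ne', zpow_add_one₀ hq0.ne',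
    show n + 1 + 1 + 1 = n + 3 by ring] at e2
  generalize q ^ (n + 1) = u at *
  have key : q * (P n - P (n + 1)) =
      (1 - q) * (P (n + 1) - u * P (n + 2)) + u ^ 2 * q ^ 2 * (P (n + 2) - P (n + 3)) := by
    linear_combination q * e0 + (-1 - u * q) * e1 + u * e2
  have h3 : 0 ≤ P (n + 1) - u * P (n + 2) := by nlinarith [hP (n + 2)]
  have h4 : 0 ≤ q * (P n - P (n + 1)) := by
    rw [key]
    have := mul_nonneg (sub_nonneg.2 hq1.le) h3
    have := mul_nonneg (show 0 ≤ u ^ 2 * q ^ 2 by positivity) (sub_nonneg.2 h2)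
    linarith
  linarith [nonneg_of_mul_nonneg_right h4 hq0]

lemma succ_le_of_recursion_of_neg_one_le (hq0 : 0 < q) (hq1 : q < 1) (hP : ∀ n, 0 ≤ P n)
    (hrec : ∀ n, P n = q ^ (n + 1) * (1 - P (n + 1))) {n : ℤ} (hn : -1 ≤ n) :
    P (n + 1) ≤ P n := by
  obtain ⟨N, hN⟩ := exists_pow_lt_of_lt_one (sub_pos.2 hq1) hq1
  have key : ∀ k : ℕ, ∀ n : ℤ, -1 ≤ n → (N : ℤ) ≤ n + k → P (n + 1) ≤ P n := by
    intro k
    induction k with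
    | zero =>
      intro n _ h
      refine succ_le_of_recursion_of_large hq0 hP hrec (le_trans ?_ hN.le)
      rw [← zpow_natCast]
      exact zpow_le_zpow_right_of_le_one₀ hq0 hq1.le (by push_cast at h; omega)
    | succ k ih =>
      intro n hn h
      push_cast at h
      have h1 := ih (n + 1) (by omega) (by omega)
      have h2 := ih (n + 2) (by omega) (by omega)
      rw [show n + 1 + 1 = n + 2 by ring] at h1
      rw [show n + 2 + 1 = n + 3 by ring] at h2
      exact succ_le_of_recursion_step hq0 hq1 hP hrec hn h1 h2
  exact key (N + 1) n hn (by push_cast; omega)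

lemma reflection_of_recursion (hq0 : 0 < q)
    (hrec : ∀ n, P n = q ^ (n + 1) * (1 - P (n + 1))) (k : ℕ) :
    P (-1 - k) = 1 - P k := by
  induction k with
  | zero =>
    have := hrec (-1)
    simpa using this
  | succ k ih =>
    have h1 := hrec (-1 - (k + 1 : ℤ))
    rw [show (-1 - (k + 1 : ℤ)) + 1 = -1 - k by ring, ih,
      show (-1 - k : ℤ) = -(k + 1) by ring, zpow_neg] at h1
    have h2 := hrec k
    push_cast
    rw [h1, sub_sub_cancel, h2, inv_mul_cancel_left₀ (zpow_pos hq0 _).ne']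

lemma succ_le_of_recursion (hq0 : 0 < q) (hq1 : q < 1) (hP : ∀ n, 0 ≤ P n)
    (hrec : ∀ n, P n = q ^ (n + 1) * (1 - P (n + 1))) (n : ℤ) : P (n + 1) ≤ P n := by
  rcases le_or_gt (-1) n with hn | hn
  · exact succ_le_of_recursion_of_neg_one_le hq0 hq1 hP hrec hn
  · obtain ⟨k, hk⟩ := Int.eq_ofNat_of_zero_le (show 0 ≤ -2 - n by omega)
    have h1 := reflection_of_recursion hq0 hrec k
    have h2 := reflection_of_recursion hq0 hrec (k + 1)
    have h3 := succ_le_of_recursion_of_neg_one_le hq0 hq1 hP hrec (show -1 ≤ (k : ℤ) by omega)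
    rw [show (-1 - k : ℤ) = n + 1 by omega] at h1
    push_cast at h2
    rw [show (-1 - (k + 1) : ℤ) = n by omega] at h2
    linarith

lemma logistic_le_of_recursion (hq0 : 0 < q) (hq1 : q < 1) (hP : ∀ n, 0 ≤ P n)
    (hrec : ∀ n, P n = q ^ (n + 1) * (1 - P (n + 1))) (n : ℤ) :
    q ^ (n + 1) / (1 + q ^ (n + 1)) ≤ P n := by
  have hu := zpow_pos hq0 (n + 1)
  rw [div_le_iff₀ (by positivity)]
  nlinarith [hrec n, succ_le_of_recursion hq0 hq1 hP hrec n]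

lemma le_logistic_of_recursion (hq0 : 0 < q) (hq1 : q < 1) (hP : ∀ n, 0 ≤ P n)
    (hrec : ∀ n, P n = q ^ (n + 1) * (1 - P (n + 1))) (n : ℤ) :
    P n ≤ q ^ n / (1 + q ^ n) := by
  have hu := zpow_pos hq0 n
  have h1 := hrec (n - 1)
  have h2 := succ_le_of_recursion hq0 hq1 hP hrec (n - 1)
  rw [sub_add_cancel] at h1 h2
  rw [le_div_iff₀ (by positivity)]
  nlinarith

end Recursion

lemma tendsto_mul_floor_div (x : ℝ) :
    Filter.Tendsto (fun r : ℝ => r * (⌊x / r⌋ : ℝ)) (nhdsWithin 0 (Set.Ioi 0)) (nhds x) := by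
  have hr : Filter.Tendsto (fun r : ℝ => r) (nhdsWithin 0 (Set.Ioi 0)) (nhds 0) :=
    tendsto_nhdsWithin_of_tendsto_nhds Filter.tendsto_id
  have hlow : Filter.Tendsto (fun r : ℝ => x - r) (nhdsWithin 0 (Set.Ioi 0)) (nhds x) := by
    simpa using (tendsto_const_nhds (x := x)).sub hr
  refine tendsto_of_tendsto_of_tendsto_of_le_of_le' hlow tendsto_const_nhds ?_ ?_ <;>
  filter_upwards [self_mem_nhdsWithin] with r (hr : 0 < r)
  · have h1 := Int.lt_floor_add_one (x / r)
    rw [div_lt_iff₀ hr] at h1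
    linarith
  · have h1 := Int.floor_le (x / r)
    rw [le_div_iff₀ hr] at h1
    linarith

open scoped Classical in
theorem canonical_bulk_logistic_profile (x : ℝ) :
    Filter.Tendsto (fun r : ℝ =>
        (∑' lam : IntPartition,
            if ∃ j : ℕ, (lam.part j : ℤ) - (j : ℤ) - 1 = ⌊x / r⌋ then
              Real.exp (-r * (lam.size : ℝ))
            else 0) /
          (∑' lam : IntPartition, Real.exp (-r * (lam.size : ℝ))))
      (nhdsWithin 0 (Set.Ioi 0))
      (nhds (Real.exp (-x) / (1 + Real.exp (-x)))) := by
  have hexp : ∀ (r : ℝ) (m : ℕ), Real.exp (-r * m) = Real.exp (-r) ^ m := fun r m => by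
    rw [← Real.exp_nat_mul, mul_comm]
  have hzpow : ∀ (r : ℝ) (m : ℤ), Real.exp (-r) ^ m = Real.exp (-(r * m)) := fun r m => by
    rw [← Real.rpow_intCast, ← Real.exp_mul, neg_mul]
  have hfun : ∀ r : ℝ, (∑' lam : IntPartition,
        if ∃ j : ℕ, (lam.part j : ℤ) - (j : ℤ) - 1 = ⌊x / r⌋ then
          Real.exp (-r * (lam.size : ℝ)) else 0) /
        (∑' lam : IntPartition, Real.exp (-r * (lam.size : ℝ))) =
      IntPartition.occupation (Real.exp (-r)) ⌊x / r⌋ := by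
    intro r
    simp only [hexp]
    rfl
  simp only [hfun]
  have hcont : Continuous fun y : ℝ => Real.exp (-y) / (1 + Real.exp (-y)) :=
    (by fun_prop : Continuous fun y : ℝ => Real.exp (-y)).div (by fun_prop)
      fun y => by positivity
  have hfloor := tendsto_mul_floor_div x
  have hr : Filter.Tendsto (fun r : ℝ => r) (nhdsWithin 0 (Set.Ioi 0)) (nhds 0) :=
    tendsto_nhdsWithin_of_tendsto_nhds Filter.tendsto_id
  have hfloor' : Filter.Tendsto (fun r : ℝ => r * ((⌊x / r⌋ + 1 : ℤ) : ℝ))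
      (nhdsWithin 0 (Set.Ioi 0)) (nhds x) := by
    simpa [mul_add] using hfloor.add hr
  refine tendsto_of_tendsto_of_tendsto_of_le_of_le' ((hcont.tendsto x).comp hfloor')
    ((hcont.tendsto x).comp hfloor) ?_ ?_ <;>
  filter_upwards [self_mem_nhdsWithin] with r (hr : 0 < r) <;>
  have hq0 := Real.exp_pos (-r) <;>
  have hq1 : Real.exp (-r) < 1 := Real.exp_lt_one_iff.2 (by linarith)
  · simpa only [Function.comp_apply, hzpow] using
      logistic_le_of_recursion hq0 hq1 (IntPartition.occupation_nonneg hq0)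
        (IntPartition.occupation_recursion hq0 hq1) ⌊x / r⌋
  · simpa only [Function.comp_apply, hzpow] using
      le_logistic_of_recursion hq0 hq1 (IntPartition.occupation_nonneg hq0)
        (IntPartition.occupation_recursion hq0 hq1) ⌊x / r⌋
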